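/- arXiv:0802.3517 — 8 statements merged into one kernel-verified Lean document; each statement's English description precedes it below -/
import Mathlib

section
/- Let (S,T) be a Moufang-Mal'tsev pair, set P := -(S+T), define the triality conjugates S⁺ := T - P, T⁺ := P - S, P⁺ := S - T, and define the Yamagutian Y : M × M → L by Y(x;y) := (1/6)([S_x,S_y] + [T_x,T_y] + [P_x,P_y]). Then 6Y(x;y) = [S⁺_x, S⁺_y] + S⁺_{[x,y]} = [T⁺_x, T⁺_y] + T⁺_{[x,y]} = [P⁺_x, P⁺_y] + P⁺_{[x,y]} for all x, y in M. -/
/-- Moufang-Mal'tsev pair: context shared by all statements.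
`F` is a field of characteristic ≠ 2, 3; `M` an `F`-vector space with an
anticommutative bilinear multiplication `mul`; `L` a Lie algebra over `F`;
`S, T : M →ₗ[F] L` satisfy the Moufang-Mal'tsev relations. -/
theorem stmt_10
    (F : Type*) [Field F] (hchar2 : (2 : F) ≠ 0) (hchar3 : (3 : F) ≠ 0)
    (M : Type*) [AddCommGroup M] [Module F M]
    (L : Type*) [LieRing L] [LieAlgebra F L]
    (mul : M →ₗ[F] M →ₗ[F] M)
    (anticomm : ∀ x y : M, mul x y = - mul y x)
    (S T : M →ₗ[F] L)
    (hST1 : ∀ x y : M, ⁅S x, S y⁆ = S (mul x y) - (2 : F) • ⁅S x, T y⁆)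
    (hST2 : ∀ x y : M, ⁅T x, T y⁆ = T (mul y x) - (2 : F) • ⁅T x, S y⁆)
    (P : M →ₗ[F] L) (hP : P = -(S + T))
    (Sp : M →ₗ[F] L) (hSp : Sp = T - P)
    (Tp : M →ₗ[F] L) (hTp : Tp = P - S)
    (Pp : M →ₗ[F] L) (hPp : Pp = S - T)
    (Y : M → M → L)
    (hY : ∀ x y : M, Y x y = (6 : F)⁻¹ • (⁅S x, S y⁆ + ⁅T x, T y⁆ + ⁅P x, P y⁆))
    :
    ∀ x y : M,
      (6 : F) • Y x y = ⁅Sp x, Sp y⁆ + Sp (mul x y) ∧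
      (6 : F) • Y x y = ⁅Tp x, Tp y⁆ + Tp (mul x y) ∧
      (6 : F) • Y x y = ⁅Pp x, Pp y⁆ + Pp (mul x y) := by
  intro x y
  have h6 : (6 : F) ≠ 0 := by
    rw [show (6 : F) = 2 * 3 by norm_num]
    exact mul_ne_zero hchar2 hchar3
  have hcross : ⁅T x, S y⁆ = ⁅S x, T y⁆ := by
    have hxy := hST1 x y
    have hyx := hST1 y x
    rw [anticomm y x, map_neg, ← lie_skew (S y) (S x), ← lie_skew (S y) (T x)] at hyx
    apply smul_right_injective L hchar2
    change (2 : F) • ⁅T x, S y⁆ = (2 : F) • ⁅S x, T y⁆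
    linear_combination (norm := module) (-1 : F) • hxy + (-1 : F) • hyx
  have hSS := hST1 x y
  have hTT := hST2 x y
  rw [anticomm y x, map_neg, hcross] at hTT
  rw [hY, smul_inv_smul₀ h6, hSp, hTp, hPp, hP]
  simp only [LinearMap.sub_apply, LinearMap.neg_apply, LinearMap.add_apply, lie_add, add_lie,
    lie_sub, sub_lie, lie_neg, neg_lie, hcross, hSS, hTT]
  refine ⟨?_, ?_, ?_⟩ <;> module
end

section
/- Let (S,T) be a Moufang-Mal'tsev pair, set P := -(S+T), define the triality conjugates S⁺ := T - P, T⁺ := P - S, P⁺ := S - T, and define the Yamagutian Y : M × M → L by Y(x;y) := (1/6)([S_x,S_y] + [T_x,T_y] + [P_x,P_y]). Then 18Y(x;y) = [S⁺_x, S⁺_y] + [T⁺_x, T⁺_y] + [P⁺_x, P⁺_y] for all x, y in M. -/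
/-- Moufang-Mal'tsev pair: context shared by all statements.
`F` is a field of characteristic ≠ 2, 3; `M` an `F`-vector space with an
anticommutative bilinear multiplication `mul`; `L` a Lie algebra over `F`;
`S, T : M →ₗ[F] L` satisfy the Moufang-Mal'tsev relations. -/
theorem stmt_11
    (F : Type*) [Field F] (hchar2 : (2 : F) ≠ 0) (hchar3 : (3 : F) ≠ 0)
    (M : Type*) [AddCommGroup M] [Module F M]
    (L : Type*) [LieRing L] [LieAlgebra F L]
    (mul : M →ₗ[F] M →ₗ[F] M)
    (anticomm : ∀ x y : M, mul x y = - mul y x)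
    (S T : M →ₗ[F] L)
    (hST1 : ∀ x y : M, ⁅S x, S y⁆ = S (mul x y) - (2 : F) • ⁅S x, T y⁆)
    (hST2 : ∀ x y : M, ⁅T x, T y⁆ = T (mul y x) - (2 : F) • ⁅T x, S y⁆)
    (P : M →ₗ[F] L) (hP : P = -(S + T))
    (Sp : M →ₗ[F] L) (hSp : Sp = T - P)
    (Tp : M →ₗ[F] L) (hTp : Tp = P - S)
    (Pp : M →ₗ[F] L) (hPp : Pp = S - T)
    (Y : M → M → L)
    (hY : ∀ x y : M, Y x y = (6 : F)⁻¹ • (⁅S x, S y⁆ + ⁅T x, T y⁆ + ⁅P x, P y⁆))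
    :
    ∀ x y : M,
      (18 : F) • Y x y = ⁅Sp x, Sp y⁆ + ⁅Tp x, Tp y⁆ + ⁅Pp x, Pp y⁆ := by
  intro x y
  have h6 : (6 : F) ≠ 0 := by
    rw [show (6 : F) = 2 * 3 by norm_num]
    exact mul_ne_zero hchar2 hchar3
  have h18 : (18 : F) * 6⁻¹ = 3 := by
    field_simp
    norm_num
  rw [hY, smul_smul, h18]
  subst hSp hTp hPp hP
  simp only [LinearMap.sub_apply, LinearMap.neg_apply, LinearMap.add_apply, lie_sub, sub_lie,
    lie_add, add_lie, lie_neg, neg_lie]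
  module
end

section
/- Let (S,T) be a Moufang-Mal'tsev pair, set P := -(S+T), and define the Yamagutian Y : M × M → L by Y(x;y) := (1/6)([S_x,S_y] + [T_x,T_y] + [P_x,P_y]). Then for all x, y in M: [S_x, S_y] = 2Y(x;y) + (1/3)S_{[x,y]} + (2/3)T_{[x,y]}, [S_x, T_y] = -Y(x;y) + (1/3)S_{[x,y]} - (1/3)T_{[x,y]}, and [T_x, T_y] = 2Y(x;y) - (2/3)S_{[x,y]} - (1/3)T_{[x,y]}. -/
/-- Moufang-Mal'tsev pair: context shared by all statements.
`F` is a field of characteristic ≠ 2, 3; `M` an `F`-vector space with an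
anticommutative bilinear multiplication `mul`; `L` a Lie algebra over `F`;
`S, T : M →ₗ[F] L` satisfy the Moufang-Mal'tsev relations. -/
theorem stmt_12
    (F : Type*) [Field F] (hchar2 : (2 : F) ≠ 0) (hchar3 : (3 : F) ≠ 0)
    (M : Type*) [AddCommGroup M] [Module F M]
    (L : Type*) [LieRing L] [LieAlgebra F L]
    (mul : M →ₗ[F] M →ₗ[F] M)
    (anticomm : ∀ x y : M, mul x y = - mul y x)
    (S T : M →ₗ[F] L)
    (hST1 : ∀ x y : M, ⁅S x, S y⁆ = S (mul x y) - (2 : F) • ⁅S x, T y⁆)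
    (hST2 : ∀ x y : M, ⁅T x, T y⁆ = T (mul y x) - (2 : F) • ⁅T x, S y⁆)
    (P : M →ₗ[F] L) (hP : P = -(S + T))
    (Y : M → M → L)
    (hY : ∀ x y : M, Y x y = (6 : F)⁻¹ • (⁅S x, S y⁆ + ⁅T x, T y⁆ + ⁅P x, P y⁆))
    :
    ∀ x y : M,
      ⁅S x, S y⁆ = (2 : F) • Y x y + (3 : F)⁻¹ • S (mul x y) + (2 / 3 : F) • T (mul x y) ∧
      ⁅S x, T y⁆ = - Y x y + (3 : F)⁻¹ • S (mul x y) - (3 : F)⁻¹ • T (mul x y) ∧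
      ⁅T x, T y⁆ = (2 : F) • Y x y - (2 / 3 : F) • S (mul x y) - (3 : F)⁻¹ • T (mul x y) := by
  intro x y
  have hSS : ⁅S x, S y⁆ = S (mul x y) - (2 : F) • ⁅T x, S y⁆ := by
    have h := hST1 y x
    rw [anticomm y x, map_neg, ← lie_skew (S y) (S x), ← lie_skew (S y) (T x)] at h
    rw [← neg_inj, h]
    module
  have hcomm : ⁅T x, S y⁆ = ⁅S x, T y⁆ :=
    smul_right_injective L hchar2 (sub_right_injective (hSS.symm.trans (hST1 x y)))
  have hTT : ⁅T x, T y⁆ = -T (mul x y) - (2 : F) • ⁅S x, T y⁆ := by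
    rw [hST2, anticomm y x, map_neg, hcomm]
  have hYxy : Y x y = (3 : F)⁻¹ • S (mul x y) - (3 : F)⁻¹ • T (mul x y) - ⁅S x, T y⁆ := by
    have h6 : (6 : F)⁻¹ = 2⁻¹ * 3⁻¹ := by
      rw [← mul_inv]
      norm_num
    rw [hY, hP, h6]
    simp only [LinearMap.neg_apply, LinearMap.add_apply, neg_lie, lie_neg, add_lie, lie_add,
      hcomm, hTT, hST1 x y]
    match_scalars <;> field_simp <;> ring
  rw [hYxy, hTT, hST1 x y]
  refine ⟨?_, ?_, ?_⟩ <;> match_scalars <;> field_simp <;> ring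
end

section
/- Let (S,T) be a Moufang-Mal'tsev pair, set P := -(S+T), and define the Yamagutian Y : M × M → L by Y(x;y) := (1/6)([S_x,S_y] + [T_x,T_y] + [P_x,P_y]). Then for all x, y in M: [T_x, T_y] = 2Y(x;y) + (1/3)T_{[x,y]} + (2/3)P_{[x,y]}, [T_x, P_y] = -Y(x;y) + (1/3)T_{[x,y]} - (1/3)P_{[x,y]}, and [P_x, P_y] = 2Y(x;y) - (2/3)T_{[x,y]} - (1/3)P_{[x,y]}. -/
/-- Moufang-Mal'tsev pair: context shared by all statements.
`F` is a field of characteristic ≠ 2, 3; `M` an `F`-vector space with an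
anticommutative bilinear multiplication `mul`; `L` a Lie algebra over `F`;
`S, T : M →ₗ[F] L` satisfy the Moufang-Mal'tsev relations. -/
theorem stmt_13
    (F : Type*) [Field F] (hchar2 : (2 : F) ≠ 0) (hchar3 : (3 : F) ≠ 0)
    (M : Type*) [AddCommGroup M] [Module F M]
    (L : Type*) [LieRing L] [LieAlgebra F L]
    (mul : M →ₗ[F] M →ₗ[F] M)
    (anticomm : ∀ x y : M, mul x y = - mul y x)
    (S T : M →ₗ[F] L)
    (hST1 : ∀ x y : M, ⁅S x, S y⁆ = S (mul x y) - (2 : F) • ⁅S x, T y⁆)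
    (hST2 : ∀ x y : M, ⁅T x, T y⁆ = T (mul y x) - (2 : F) • ⁅T x, S y⁆)
    (P : M →ₗ[F] L) (hP : P = -(S + T))
    (Y : M → M → L)
    (hY : ∀ x y : M, Y x y = (6 : F)⁻¹ • (⁅S x, S y⁆ + ⁅T x, T y⁆ + ⁅P x, P y⁆))
    :
    ∀ x y : M,
      ⁅T x, T y⁆ = (2 : F) • Y x y + (3 : F)⁻¹ • T (mul x y) + (2 / 3 : F) • P (mul x y) ∧
      ⁅T x, P y⁆ = - Y x y + (3 : F)⁻¹ • T (mul x y) - (3 : F)⁻¹ • P (mul x y) ∧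
      ⁅P x, P y⁆ = (2 : F) • Y x y - (2 / 3 : F) • T (mul x y) - (3 : F)⁻¹ • P (mul x y) := by
  intro x y
  have h6 : (6 : F) = 2 * 3 := by norm_num
  have hS : ⁅S x, S y⁆ = S (mul x y) - (2 : F) • ⁅T x, S y⁆ := by
    have h := hST1 y x
    rw [anticomm y x, ← lie_skew (S y) (S x), ← lie_skew (S y) (T x), map_neg] at h
    rw [← neg_inj, h]
    module
  have hT : ⁅T x, T y⁆ = -T (mul x y) - (2 : F) • ⁅T x, S y⁆ := by
    rw [hST2, anticomm y x, map_neg]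
  have hcomm : ⁅S x, T y⁆ = ⁅T x, S y⁆ :=
    smul_right_injective L hchar2 (sub_right_injective ((hST1 x y).symm.trans hS))
  have hPP : ⁅P x, P y⁆ = S (mul x y) - T (mul x y) - (2 : F) • ⁅T x, S y⁆ := by
    simp only [hP, LinearMap.neg_apply, LinearMap.add_apply, neg_lie, lie_neg, add_lie, lie_add,
      hcomm, hS, hT]
    module
  have hYxy : Y x y = (3 : F)⁻¹ • (S (mul x y) - T (mul x y)) - ⁅T x, S y⁆ := by
    rw [hY, hS, hT, hPP, h6]
    match_scalars <;> field_simp <;> ring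
  have hPmul : P (mul x y) = -(S (mul x y) + T (mul x y)) := by simp [hP]
  have hTP : ⁅T x, P y⁆ = T (mul x y) + ⁅T x, S y⁆ := by
    simp only [hP, LinearMap.neg_apply, LinearMap.add_apply, lie_neg, lie_add, hT]
    module
  rw [hPP, hTP, hT, hYxy, hPmul]
  refine ⟨?_, ?_, ?_⟩ <;> match_scalars <;> field_simp <;> ring
end

section
/- Let (S,T) be a Moufang-Mal'tsev pair, set P := -(S+T), and define the Yamagutian Y : M × M → L by Y(x;y) := (1/6)([S_x,S_y] + [T_x,T_y] + [P_x,P_y]). Then for all x, y in M: [P_x, P_y] = 2Y(x;y) + (1/3)P_{[x,y]} + (2/3)S_{[x,y]}, [P_x, S_y] = -Y(x;y) + (1/3)P_{[x,y]} - (1/3)S_{[x,y]}, and [S_x, S_y] = 2Y(x;y) - (2/3)P_{[x,y]} - (1/3)S_{[x,y]}. -/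
/-- Moufang-Mal'tsev pair: context shared by all statements.
`F` is a field of characteristic ≠ 2, 3; `M` an `F`-vector space with an
anticommutative bilinear multiplication `mul`; `L` a Lie algebra over `F`;
`S, T : M →ₗ[F] L` satisfy the Moufang-Mal'tsev relations. -/
theorem stmt_14
    (F : Type*) [Field F] (hchar2 : (2 : F) ≠ 0) (hchar3 : (3 : F) ≠ 0)
    (M : Type*) [AddCommGroup M] [Module F M]
    (L : Type*) [LieRing L] [LieAlgebra F L]
    (mul : M →ₗ[F] M →ₗ[F] M)
    (anticomm : ∀ x y : M, mul x y = - mul y x)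
    (S T : M →ₗ[F] L)
    (hST1 : ∀ x y : M, ⁅S x, S y⁆ = S (mul x y) - (2 : F) • ⁅S x, T y⁆)
    (hST2 : ∀ x y : M, ⁅T x, T y⁆ = T (mul y x) - (2 : F) • ⁅T x, S y⁆)
    (P : M →ₗ[F] L) (hP : P = -(S + T))
    (Y : M → M → L)
    (hY : ∀ x y : M, Y x y = (6 : F)⁻¹ • (⁅S x, S y⁆ + ⁅T x, T y⁆ + ⁅P x, P y⁆))
    :
    ∀ x y : M,
      ⁅P x, P y⁆ = (2 : F) • Y x y + (3 : F)⁻¹ • P (mul x y) + (2 / 3 : F) • S (mul x y) ∧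
      ⁅P x, S y⁆ = - Y x y + (3 : F)⁻¹ • P (mul x y) - (3 : F)⁻¹ • S (mul x y) ∧
      ⁅S x, S y⁆ = (2 : F) • Y x y - (2 / 3 : F) • P (mul x y) - (3 : F)⁻¹ • S (mul x y) := by
  intro x y
  have six_ne_zero : (6 : F) ≠ 0 := by
    have h := mul_ne_zero hchar2 hchar3
    norm_num at h
    exact h
  have hTS : ⁅T x, S y⁆ = ⁅S x, T y⁆ := by
    have hyx := hST1 y x
    rw [anticomm y x, map_neg, ← lie_skew (S y) (S x), ← lie_skew (S y) (T x), hST1 x y] at hyx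
    refine smul_right_injective L hchar2 ?_
    linear_combination (norm := module) -hyx
  have hTT := hST2 x y
  rw [anticomm y x, map_neg, hTS] at hTT
  have hYxy : Y x y = (3 : F)⁻¹ • (S (mul x y) - T (mul x y)) - ⁅S x, T y⁆ := by
    simp only [hY, hP, LinearMap.neg_apply, LinearMap.add_apply, neg_lie, lie_neg, add_lie,
      lie_add, hST1 x y, hTT, hTS]
    match_scalars <;> field_simp <;> norm_num
  simp only [hYxy, hP, LinearMap.neg_apply, LinearMap.add_apply, neg_lie, lie_neg, add_lie,
    lie_add, hST1 x y, hTT, hTS]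
  refine ⟨?_, ?_, ?_⟩ <;> match_scalars <;> field_simp <;> norm_num
end

section
/- Let (S,T) be a Moufang-Mal'tsev pair, set P := -(S+T), and define the Yamagutian Y : M × M → L by Y(x;y) := (1/6)([S_x,S_y] + [T_x,T_y] + [P_x,P_y]). Then for all x, y, z in M: 6[Y(x;y), S_z] = 3[[S_x,S_y], S_z] - S_{[[x,y],z]}, 6[Y(x;y), T_z] = 3[[T_x,T_y], T_z] - T_{[[x,y],z]}, and 6[Y(x;y), P_z] = 3[[P_x,P_y], P_z] - P_{[[x,y],z]}. -/
/-- Moufang-Mal'tsev pair: context shared by all statements.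
`F` is a field of characteristic ≠ 2, 3; `M` an `F`-vector space with an
anticommutative bilinear multiplication `mul`; `L` a Lie algebra over `F`;
`S, T : M →ₗ[F] L` satisfy the Moufang-Mal'tsev relations. -/
theorem stmt_15
    (F : Type*) [Field F] (hchar2 : (2 : F) ≠ 0) (hchar3 : (3 : F) ≠ 0)
    (M : Type*) [AddCommGroup M] [Module F M]
    (L : Type*) [LieRing L] [LieAlgebra F L]
    (mul : M →ₗ[F] M →ₗ[F] M)
    (anticomm : ∀ x y : M, mul x y = - mul y x)
    (S T : M →ₗ[F] L)
    (hST1 : ∀ x y : M, ⁅S x, S y⁆ = S (mul x y) - (2 : F) • ⁅S x, T y⁆)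
    (hST2 : ∀ x y : M, ⁅T x, T y⁆ = T (mul y x) - (2 : F) • ⁅T x, S y⁆)
    (P : M →ₗ[F] L) (hP : P = -(S + T))
    (Y : M → M → L)
    (hY : ∀ x y : M, Y x y = (6 : F)⁻¹ • (⁅S x, S y⁆ + ⁅T x, T y⁆ + ⁅P x, P y⁆))
    :
    ∀ x y z : M,
      (6 : F) • ⁅Y x y, S z⁆ = (3 : F) • ⁅⁅S x, S y⁆, S z⁆ - S (mul (mul x y) z) ∧
      (6 : F) • ⁅Y x y, T z⁆ = (3 : F) • ⁅⁅T x, T y⁆, T z⁆ - T (mul (mul x y) z) ∧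
      (6 : F) • ⁅Y x y, P z⁆ = (3 : F) • ⁅⁅P x, P y⁆, P z⁆ - P (mul (mul x y) z) := by
  have h6 : (6 : F) ≠ 0 := by
    rw [show (6 : F) = 2 * 3 by norm_num]
    exact mul_ne_zero hchar2 hchar3
  have hTS (x y : M) : ⁅T x, S y⁆ = ⁅S x, T y⁆ := by
    have h : (2 : F) • ⁅T x, S y⁆ = (2 : F) • ⁅S x, T y⁆ := by
      have hxy := hST1 x y
      have hyx := hST1 y x
      rw [anticomm y x, map_neg, ← lie_skew (S y), ← lie_skew (S y) (T x), smul_neg] at hyx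
      linear_combination (norm := module) -hxy - hyx
    exact smul_right_injective L hchar2 h
  have hTT (x y : M) : ⁅T x, T y⁆ = -T (mul x y) - (2 : F) • ⁅S x, T y⁆ := by
    rw [hST2, hTS, anticomm y x, map_neg]
  have hPP (x y : M) : ⁅P x, P y⁆ = S (mul x y) - T (mul x y) - (2 : F) • ⁅S x, T y⁆ := by
    simp only [hP, LinearMap.neg_apply, LinearMap.add_apply, neg_lie, lie_neg, add_lie, lie_add,
      hST1, hTT, hTS]
    module
  have hY6 (x y : M) (l : L) : (6 : F) • ⁅Y x y, l⁆ =
      (2 : F) • ⁅S (mul x y), l⁆ - (2 : F) • ⁅T (mul x y), l⁆ - (6 : F) • ⁅⁅S x, T y⁆, l⁆ := by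
    rw [hY, smul_lie, smul_inv_smul₀ h6, hST1, hTT, hPP]
    simp only [add_lie, sub_lie, neg_lie, smul_lie]
    module
  intro x y z
  refine ⟨?_, ?_, ?_⟩
  · rw [hY6, hST1 x y]
    simp only [sub_lie, smul_lie, hST1 (mul x y), hTS]
    module
  · rw [hY6, hTT x y]
    simp only [sub_lie, neg_lie, smul_lie, hTT (mul x y)]
    module
  · rw [hY6, hPP x y]
    simp only [hP, LinearMap.neg_apply, LinearMap.add_apply, sub_lie, smul_lie, lie_neg, lie_add,
      hST1 (mul x y), hTT (mul x y), hTS]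
    module
end

section
/- Let (S,T) be a Moufang-Mal'tsev pair and set P := -(S+T). Then the triality symmetric identity [[S_x,S_y], S_z] + [[T_x,T_y], T_z] + [[P_x,P_y], P_z] = 0 holds in L for all x, y, z in M. -/
/-- The mixed brackets of a Moufang-Mal'tsev pair are symmetric under exchanging `S` and `T`. -/
theorem lie_mixed_swap {F M L : Type*} [Field F] (hchar2 : (2 : F) ≠ 0)
    [AddCommGroup M] [Module F M] [LieRing L] [LieAlgebra F L]
    (mul : M →ₗ[F] M →ₗ[F] M) (anticomm : ∀ x y : M, mul x y = - mul y x)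
    (S T : M →ₗ[F] L)
    (hST1 : ∀ x y : M, ⁅S x, S y⁆ = S (mul x y) - (2 : F) • ⁅S x, T y⁆) (x y : M) :
    ⁅T x, S y⁆ = ⁅S x, T y⁆ := by
  have h : (2 : F) • (⁅T x, S y⁆ - ⁅S x, T y⁆) = 0 := by
    have hskew := lie_skew (S x) (S y)
    rw [hST1 x y, hST1 y x, anticomm x y, map_neg, ← lie_skew (S y) (T x), smul_neg] at hskew
    rw [smul_sub, sub_eq_zero]
    linear_combination (norm := module) -hskew
  exact sub_eq_zero.mp ((smul_eq_zero.mp h).resolve_left hchar2)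

/-- Moufang-Mal'tsev pair: context shared by all statements.
`F` is a field of characteristic ≠ 2, 3; `M` an `F`-vector space with an
anticommutative bilinear multiplication `mul`; `L` a Lie algebra over `F`;
`S, T : M →ₗ[F] L` satisfy the Moufang-Mal'tsev relations. -/
theorem stmt_16
    (F : Type*) [Field F] (hchar2 : (2 : F) ≠ 0) (hchar3 : (3 : F) ≠ 0)
    (M : Type*) [AddCommGroup M] [Module F M]
    (L : Type*) [LieRing L] [LieAlgebra F L]
    (mul : M →ₗ[F] M →ₗ[F] M)
    (anticomm : ∀ x y : M, mul x y = - mul y x)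
    (S T : M →ₗ[F] L)
    (hST1 : ∀ x y : M, ⁅S x, S y⁆ = S (mul x y) - (2 : F) • ⁅S x, T y⁆)
    (hST2 : ∀ x y : M, ⁅T x, T y⁆ = T (mul y x) - (2 : F) • ⁅T x, S y⁆)
    (P : M →ₗ[F] L) (hP : P = -(S + T))
    :
    ∀ x y z : M,
      ⁅⁅S x, S y⁆, S z⁆ + ⁅⁅T x, T y⁆, T z⁆ + ⁅⁅P x, P y⁆, P z⁆ = 0 := by
  intro x y z
  have swap := lie_mixed_swap hchar2 mul anticomm S T hST1
  have hSS := hST1 x y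
  have hTT : ⁅T x, T y⁆ = -T (mul x y) - (2 : F) • ⁅S x, T y⁆ := by
    rw [hST2, swap, anticomm y x, map_neg]
  have hPP : ⁅P x, P y⁆ = S (mul x y) - T (mul x y) - (2 : F) • ⁅S x, T y⁆ := by
    simp only [hP, LinearMap.neg_apply, LinearMap.add_apply, neg_lie, lie_neg,
      add_lie, lie_add, hSS, hTT, swap]
    module
  have hPz : P z = -(S z + T z) := by simp [hP]
  rw [hPP, hSS, hTT, hPz]
  simp only [sub_lie, neg_lie, lie_neg, lie_add, smul_lie, swap]
  module
end

section
/- Let (S,T) be a Moufang-Mal'tsev pair, set P := -(S+T), and define the Yamagutian Y : M × M → L by Y(x;y) := (1/6)([S_x,S_y] + [T_x,T_y] + [P_x,P_y]). Then the Yamagutian satisfies the cyclic identity Y([x,y]; z) + Y([y,z]; x) + Y([z,x]; y) = 0 for all x, y, z in M. -/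
/-- Moufang-Mal'tsev pair: context shared by all statements.
`F` is a field of characteristic ≠ 2, 3; `M` an `F`-vector space with an
anticommutative bilinear multiplication `mul`; `L` a Lie algebra over `F`;
`S, T : M →ₗ[F] L` satisfy the Moufang-Mal'tsev relations. -/
theorem stmt_19
    (F : Type*) [Field F] (hchar2 : (2 : F) ≠ 0) (hchar3 : (3 : F) ≠ 0)
    (M : Type*) [AddCommGroup M] [Module F M]
    (L : Type*) [LieRing L] [LieAlgebra F L]
    (mul : M →ₗ[F] M →ₗ[F] M)
    (anticomm : ∀ x y : M, mul x y = - mul y x)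
    (S T : M →ₗ[F] L)
    (hST1 : ∀ x y : M, ⁅S x, S y⁆ = S (mul x y) - (2 : F) • ⁅S x, T y⁆)
    (hST2 : ∀ x y : M, ⁅T x, T y⁆ = T (mul y x) - (2 : F) • ⁅T x, S y⁆)
    (P : M →ₗ[F] L) (hP : P = -(S + T))
    (Y : M → M → L)
    (hY : ∀ x y : M, Y x y = (6 : F)⁻¹ • (⁅S x, S y⁆ + ⁅T x, T y⁆ + ⁅P x, P y⁆))
    :
    ∀ x y z : M,
      Y (mul x y) z + Y (mul y z) x + Y (mul z x) y = 0 := by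
  have symm_lie : ∀ x y, ⁅T x, S y⁆ = ⁅S x, T y⁆ := by
    intro x y
    have h₁ := hST1 x y
    have h₂ := hST1 y x
    rw [anticomm y x, map_neg, ← lie_skew (S y) (S x), ← lie_skew (S y) (T x)] at h₂
    have h : (2 : F) • (⁅T x, S y⁆ - ⁅S x, T y⁆) = 0 := by
      linear_combination (norm := module) -h₁ - h₂
    exact sub_eq_zero.mp ((smul_eq_zero.mp h).resolve_left hchar2)
  have lie_TT : ∀ x y, ⁅T x, T y⁆ = -T (mul x y) - (2 : F) • ⁅S x, T y⁆ := by
    intro x y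
    rw [hST2, symm_lie, anticomm y x, map_neg]
  have hY' : ∀ x y, Y x y =
      (6 : F)⁻¹ • ((2 : F) • (S (mul x y) - T (mul x y)) - (6 : F) • ⁅S x, T y⁆) := by
    intro x y
    rw [hY, hP]
    simp only [LinearMap.neg_apply, LinearMap.add_apply, neg_lie, lie_neg, add_lie, lie_add,
      symm_lie, hST1, lie_TT]
    module
  intro x y z
  have jacobi_SSS : ∀ x y z, S (mul (mul x y) z) - (2 : F) • ⁅S (mul x y), T z⁆
      - (2 : F) • ⁅⁅S x, T y⁆, S z⁆ = ⁅⁅S x, S y⁆, S z⁆ := by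
    intro x y z
    rw [hST1 x y, sub_lie, smul_lie, hST1]
  have jacobi_TTT : ∀ x y z, T (mul (mul x y) z) + (2 : F) • ⁅S (mul x y), T z⁆
      - (2 : F) • ⁅⁅S x, T y⁆, T z⁆ = ⁅⁅T x, T y⁆, T z⁆ := by
    intro x y z
    rw [lie_TT x y, sub_lie, smul_lie, neg_lie, lie_TT]
    module
  have jacobi_SST : ∀ x y z, ⁅S (mul x y), T z⁆ - (2 : F) • ⁅⁅S x, T y⁆, T z⁆
      = -⁅⁅S y, T z⁆, S x⁆ - ⁅⁅S z, T x⁆, S y⁆ := by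
    intro x y z
    have h := lie_lie (S x) (S y) (T z)
    rw [hST1 x y, sub_lie, smul_lie] at h
    rw [h, ← symm_lie x z, ← lie_skew (T x) (S z), lie_neg, ← lie_skew (S x) ⁅S y, T z⁆,
      ← lie_skew (S y) ⁅S z, T x⁆]
    module
  have cyclic : ∀ a b c : L, ⁅⁅a, b⁆, c⁆ + ⁅⁅b, c⁆, a⁆ + ⁅⁅c, a⁆, b⁆ = 0 := by
    intro a b c
    have h := lie_jacobi a b c
    rw [← lie_skew a ⁅b, c⁆, ← lie_skew b ⁅c, a⁆, ← lie_skew c ⁅a, b⁆] at h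
    linear_combination (norm := module) -h
  have hS := cyclic (S x) (S y) (S z)
  have hT := cyclic (T x) (T y) (T z)
  rw [← jacobi_SSS, ← jacobi_SSS, ← jacobi_SSS] at hS
  rw [← jacobi_TTT, ← jacobi_TTT, ← jacobi_TTT] at hT
  rw [hY', hY', hY', ← smul_add, ← smul_add]
  convert smul_zero (6 : F)⁻¹
  linear_combination (norm := module) (2 : F) • hS - (2 : F) • hT +
    (2 : F) • (jacobi_SST x y z + jacobi_SST y z x + jacobi_SST z x y)
end
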